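/- Let m ≥ 2 be an integer, σ ≥ 0 and 1/2 < γ < 1 real numbers. Then there exists a constant C > 0 such that the following holds. Let w and η be smooth complex-valued functions on (0,1] × 𝕋 such that ψ² ∂_ψ² w + 2ψ ∂_ψ w + (1/4)(w + ∂_θ² w) = η on (0,1] × 𝕋, such that the Fourier coefficients ŵ_k(1) = (1/2π)∫_𝕋 w(1,θ) e^{−ikθ} dθ vanish for all integers k with |k| ≥ 3, and such that both ||| w |||_{m,σ,γ} < ∞ and ||| η |||_{m−2,σ,γ} < ∞, where ||| u |||²_{s,σ,γ} = Σ_{k ∈ ℤ} Σ_{p+q=0}^{s} k^{2q} e^{2σ|k|} ∫₀¹ ψ^{2(p − 1/2 − γ)} |D^p û_k(ψ)|² dψ and û_k(ψ) = (1/2π)∫_𝕋 u(ψ,θ) e^{−ikθ} dθ. Then ||| w |||_{m,σ,γ} ≤ C ||| η |||_{m−2,σ,γ}. -/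

import Mathlib

open MeasureTheory Real Set ENNReal

noncomputable section

/-- The iterated partial derivative `∂_ψ^p ∂_θ^q u` of a function `u(ψ,θ)`. -/
def pder (p q : ℕ) (u : ℝ → ℝ → ℂ) : ℝ → ℝ → ℂ :=
  fun ψ θ => iteratedDeriv p (fun s => iteratedDeriv q (u s) θ) ψ

/-- The square of the Kondratev norm `‖u‖_{K_γ^m}` on `Π = (0,1] × 𝕋`:
`‖u‖²_{K_γ^m} = Σ_{p+q≤m} ∫₀¹ ∫_𝕋 ψ^(2(p-γ)) |∂_ψ^p ∂_θ^q u(ψ,θ)|² dθ dψ`. -/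
def KNormSq (γ : ℝ) (m : ℕ) (u : ℝ → ℝ → ℂ) : ℝ≥0∞ :=
  ∑ p ∈ Finset.range (m+1), ∑ q ∈ Finset.range (m+1-p),
    ∫⁻ ψ in Ioc (0:ℝ) 1, ∫⁻ θ in Ioc (0:ℝ) (2*π),
      ENNReal.ofReal (ψ ^ (2*((p:ℝ) - γ)) * ‖pder p q u ψ θ‖^2)

/-- The Kondratev norm `‖u‖_{K_γ^m}`. -/
def KNorm (γ : ℝ) (m : ℕ) (u : ℝ → ℝ → ℂ) : ℝ≥0∞ := KNormSq γ m u ^ ((1:ℝ)/2)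

/-- `u : (0,1] × 𝕋 → ℂ` is smooth: it is (jointly) smooth for `ψ > 0`
and `2π`-periodic in the angular variable `θ`. -/
def SmoothAnn (u : ℝ → ℝ → ℂ) : Prop :=
  ContDiffOn ℝ (⊤ : ℕ∞) (Function.uncurry u) (Ioi (0:ℝ) ×ˢ (univ : Set ℝ)) ∧
    ∀ ψ θ, u ψ (θ + 2*π) = u ψ θ

/-- The `k`-th Fourier coefficient in `θ`: `û_k(ψ) = (1/2π) ∫_𝕋 u(ψ,θ) e^(-ikθ) dθ`. -/
def fourierCoefAnn (u : ℝ → ℝ → ℂ) (k : ℤ) (ψ : ℝ) : ℂ :=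
  (1/(2*π) : ℂ) * ∫ θ in (0:ℝ)..(2*π), u ψ θ * Complex.exp (-(k:ℂ) * Complex.I * (θ:ℂ))

/-- The squared norm `||| u |||²_{s,σ,γ}` of the partially-analytic Kondratev space
`K_{1/2+γ}^{s,σ}(Π)`, expressed through the Fourier coefficients `û_k` in `θ`:
`||| u |||²_{s,σ,γ} = Σ_k Σ_{p+q≤s} k^(2q) e^(2σ|k|) ∫₀¹ ψ^(2(p-1/2-γ)) |D^p û_k(ψ)|² dψ`. -/
def TNormSq (s : ℕ) (σ γ : ℝ) (u : ℝ → ℝ → ℂ) : ℝ≥0∞ :=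
  ∑' k : ℤ, ∑ p ∈ Finset.range (s+1), ∑ q ∈ Finset.range (s+1-p),
    ENNReal.ofReal ((k:ℝ)^(2*q) * Real.exp (2*σ*((|k| : ℤ) : ℝ))) *
      ∫⁻ ψ in Ioc (0:ℝ) 1, ENNReal.ofReal (ψ ^ (2*((p:ℝ) - 1/2 - γ)) *
        ‖iteratedDeriv p (fourierCoefAnn u k) ψ‖^2)

section AprioriEstimate

open Filter Topology

theorem integral_deriv_eq_of_integrable_div {φ φ' : ℝ → ℝ}
    (hφ : ∀ x ∈ Ioc (0:ℝ) 1, HasDerivAt φ (φ' x) x) (h0 : ∀ x ∈ Ioc (0:ℝ) 1, 0 ≤ φ x)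
    (hi' : IntegrableOn φ' (Ioc 0 1)) (hi : IntegrableOn (fun x => x⁻¹ * φ x) (Ioc 0 1)) :
    ∫ x : ℝ in Ioc (0:ℝ) 1, φ' x = φ 1 := by
  have hii : IntervalIntegrable φ' volume 0 1 :=
    (intervalIntegrable_iff_integrableOn_Ioc_of_le zero_le_one).2 hi'
  rw [← intervalIntegral.integral_of_le zero_le_one]
  have hftc : ∀ b ∈ Ioc (0:ℝ) 1, φ b = φ 1 - ∫ x in b..1, φ' x := by
    intro b hb
    have hsub : uIcc b 1 ⊆ uIcc (0:ℝ) 1 := by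
      rw [uIcc_of_le hb.2, uIcc_of_le zero_le_one]; exact Icc_subset_Icc hb.1.le le_rfl
    rw [intervalIntegral.integral_eq_sub_of_hasDerivAt _ (hii.mono_set hsub)]
    · ring
    · intro x hx
      rw [uIcc_of_le hb.2] at hx
      exact hφ x ⟨hb.1.trans_le hx.1, hx.2⟩
  have hcont : ContinuousOn (fun b => φ 1 - ∫ x in b..1, φ' x) (uIcc 0 1) := by
    refine continuousOn_const.sub (intervalIntegral.continuousOn_primitive_interval_left ?_)
    rwa [uIcc_of_le zero_le_one, integrableOn_Icc_iff_integrableOn_Ioc]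
  set L := φ 1 - ∫ x in (0:ℝ)..1, φ' x with hL
  have hlim : Tendsto φ (𝓝[>] 0) (𝓝 L) := by
    have h1 : ContinuousWithinAt (fun b => φ 1 - ∫ x in b..1, φ' x) (Icc 0 1) 0 := by
      have := hcont 0 left_mem_uIcc
      rwa [uIcc_of_le zero_le_one] at this
    have h2 : Tendsto (fun b => φ 1 - ∫ x in b..1, φ' x) (𝓝[>] 0) (𝓝 L) :=
      h1.tendsto.mono_left (by
        rw [← nhdsWithin_Ioc_eq_nhdsGT (zero_lt_one' ℝ)]
        exact nhdsWithin_mono _ Ioc_subset_Icc_self)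
    refine h2.congr' ?_
    filter_upwards [Ioc_mem_nhdsGT (zero_lt_one' ℝ)] with b hb using (hftc b hb).symm
  have hL0 : 0 ≤ L := ge_of_tendsto hlim (by
    filter_upwards [Ioc_mem_nhdsGT (zero_lt_one' ℝ)] with b hb using h0 b hb)
  rcases hL0.eq_or_lt with h | h
  · linarith
  exfalso
  have hev := hlim.eventually (lt_mem_nhds (half_lt_self h))
  obtain ⟨d, hd, hd'⟩ := mem_nhdsGT_iff_exists_Ioc_subset.1
    (inter_mem hev (Ioc_mem_nhdsGT (zero_lt_one' ℝ)))
  have hd0 : (0:ℝ) < d := hd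
  have hsub : Ioc 0 d ⊆ Ioc (0:ℝ) 1 := fun x hx => (hd' hx).2
  have hinv : IntegrableOn (fun x : ℝ => x⁻¹) (Ioc 0 d) := by
    refine ((hi.mono_set hsub).const_mul (2 / L)).mono'
      measurable_inv.aestronglyMeasurable ?_
    refine (ae_restrict_iff' measurableSet_Ioc).2 (ae_of_all _ fun x hx => ?_)
    have h1 : L / 2 < φ x := (hd' hx).1
    have h2 : 0 < x⁻¹ := inv_pos.2 hx.1
    rw [Real.norm_of_nonneg h2.le]
    calc x⁻¹ = 2 / L * (x⁻¹ * (L / 2)) := by field_simp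
      _ ≤ _ := by gcongr
  rw [← intervalIntegrable_iff_integrableOn_Ioc_of_le hd0.le, intervalIntegrable_inv_iff] at hinv
  rcases hinv with hinv | hinv
  · exact hd0.ne hinv
  · exact hinv left_mem_uIcc

/-- The square of the weighted norm `∫₀¹ x^(-1-2γ) |u(x)|² dx`. -/
def weightedEnergy (γ : ℝ) (u : ℝ → ℂ) : ℝ :=
  ∫ x : ℝ in Ioc (0:ℝ) 1, x ^ (-1 - 2 * γ) * ‖u x‖ ^ 2

/-- Functions continuous on `(0,1]` with finite weighted energy. -/
def HasFiniteEnergy (γ : ℝ) (u : ℝ → ℂ) : Prop :=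
  ContinuousOn u (Ioc 0 1) ∧ IntegrableOn (fun x : ℝ => x ^ (-1 - 2 * γ) * ‖u x‖ ^ 2) (Ioc 0 1)

theorem weightedEnergy_nonneg (γ : ℝ) (u : ℝ → ℂ) : 0 ≤ weightedEnergy γ u :=
  setIntegral_nonneg measurableSet_Ioc fun _ hx =>
    mul_nonneg (Real.rpow_nonneg hx.1.le _) (sq_nonneg _)

theorem continuousOn_rpow_Ioc (a : ℝ) : ContinuousOn (fun x : ℝ => x ^ a) (Ioc 0 1) :=
  continuousOn_id.rpow_const fun _ hx => Or.inl hx.1.ne'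

theorem weightedEnergy_congr {γ : ℝ} {u v : ℝ → ℂ} (h : EqOn u v (Ioo 0 1)) :
    weightedEnergy γ u = weightedEnergy γ v := by
  simp only [weightedEnergy, integral_Ioc_eq_integral_Ioo]
  exact setIntegral_congr_fun measurableSet_Ioo fun x hx => by simp only [h hx]

theorem HasFiniteEnergy.congr {γ : ℝ} {u v : ℝ → ℂ} (hu : HasFiniteEnergy γ u)
    (h : EqOn v u (Ioc 0 1)) : HasFiniteEnergy γ v :=
  ⟨hu.1.congr h, hu.2.congr_fun (fun x hx => by simp only [h hx]) measurableSet_Ioc⟩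

theorem HasFiniteEnergy.const_mul {γ : ℝ} {u : ℝ → ℂ} (hu : HasFiniteEnergy γ u) (c : ℂ) :
    HasFiniteEnergy γ (fun x => c * u x) := by
  refine ⟨continuousOn_const.mul hu.1,
    IntegrableOn.congr_fun (hu.2.const_mul (‖c‖ ^ 2)) (fun x _ => ?_)
    measurableSet_Ioc⟩
  simp only [norm_mul]
  ring

theorem weightedEnergy_const_mul (γ : ℝ) (u : ℝ → ℂ) (c : ℂ) :
    weightedEnergy γ (fun x => c * u x) = ‖c‖ ^ 2 * weightedEnergy γ u := by
  rw [weightedEnergy, weightedEnergy, ← integral_const_mul]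
  refine setIntegral_congr_fun measurableSet_Ioc fun x _ => ?_
  simp only [norm_mul]
  ring

theorem weight_mul_norm_add_sq_le (γ : ℝ) (u v : ℝ → ℂ) {x : ℝ} (hx : 0 < x) :
    x ^ (-1 - 2 * γ) * ‖u x + v x‖ ^ 2 ≤
      2 * (x ^ (-1 - 2 * γ) * ‖u x‖ ^ 2) + 2 * (x ^ (-1 - 2 * γ) * ‖v x‖ ^ 2) := by
  have hw := Real.rpow_pos_of_pos hx (-1 - 2 * γ)
  have h1 : ‖u x + v x‖ ^ 2 ≤ 2 * (‖u x‖ ^ 2 + ‖v x‖ ^ 2) :=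
    (pow_le_pow_left₀ (norm_nonneg _) (norm_add_le _ _) 2).trans add_sq_le
  linarith [mul_le_mul_of_nonneg_left h1 hw.le]

theorem HasFiniteEnergy.add {γ : ℝ} {u v : ℝ → ℂ} (hu : HasFiniteEnergy γ u)
    (hv : HasFiniteEnergy γ v) : HasFiniteEnergy γ (fun x => u x + v x) := by
  refine ⟨hu.1.add hv.1, ((hu.2.const_mul 2).add (hv.2.const_mul 2)).mono' ?_ ?_⟩
  · exact ((continuousOn_rpow_Ioc _).mul ((hu.1.add hv.1).norm.pow 2)).aestronglyMeasurable
      measurableSet_Ioc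
  · refine (ae_restrict_iff' measurableSet_Ioc).2 (ae_of_all _ fun x hx => ?_)
    have hw := Real.rpow_pos_of_pos hx.1 (-1 - 2 * γ)
    rw [Real.norm_of_nonneg (by positivity)]
    exact weight_mul_norm_add_sq_le γ u v hx.1

theorem weightedEnergy_add_le {γ : ℝ} {u v : ℝ → ℂ} (hu : HasFiniteEnergy γ u)
    (hv : HasFiniteEnergy γ v) :
    weightedEnergy γ (fun x => u x + v x) ≤ 2 * weightedEnergy γ u + 2 * weightedEnergy γ v := by
  rw [weightedEnergy, weightedEnergy, weightedEnergy, ← integral_const_mul, ← integral_const_mul,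
    ← integral_add (hu.2.const_mul 2) (hv.2.const_mul 2)]
  exact setIntegral_mono_on (hu.add hv).2 ((hu.2.const_mul 2).add (hv.2.const_mul 2))
    measurableSet_Ioc fun x hx => weight_mul_norm_add_sq_le γ u v hx.1

theorem HasFiniteEnergy.euler {γ : ℝ} {h h' : ℝ → ℂ} (hi : HasFiniteEnergy γ h)
    (hi' : HasFiniteEnergy γ (fun x => (x:ℂ) * h' x)) (l : ℝ) :
    HasFiniteEnergy γ (fun x => (x:ℂ) * h' x - l * h x) :=
  (hi'.add (hi.const_mul (-l))).congr fun x _ => by ring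

/-- Weighted estimate for the first-order Euler operator `x ∂ₓ - l`. -/
theorem euler_first_order_estimate {γ l : ℝ} {h h' : ℝ → ℂ}
    (hd : ∀ x ∈ Ioc (0:ℝ) 1, HasDerivAt h (h' x) x) (hi : HasFiniteEnergy γ h)
    (hi' : HasFiniteEnergy γ (fun x => (x:ℂ) * h' x)) (hb : 0 ≤ (γ - l) * ‖h 1‖ ^ 2) :
    (γ - l) ^ 2 * weightedEnergy γ h ≤ weightedEnergy γ (fun x => (x:ℂ) * h' x - l * h x) := by
  have hGi := (hi.euler hi' l).2
  have hxhc := hi'.1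
  replace hi' := hi'.2
  obtain ⟨hhc, hi⟩ := hi
  unfold weightedEnergy
  let φ : ℝ → ℝ := fun x => x ^ (-2 * γ) * ‖h x‖ ^ 2
  let φ' : ℝ → ℝ := fun x => x ^ (-1 - 2 * γ) *
    (2 * inner ℝ (h x) ((x:ℂ) * h' x) - 2 * γ * ‖h x‖ ^ 2)
  have hφ : ∀ x ∈ Ioc (0:ℝ) 1, HasDerivAt φ (φ' x) x := by
    intro x hx
    have h1 := (hd x hx).norm_sq
    have h2 := Real.hasDerivAt_rpow_const (x := x) (p := -2 * γ) (Or.inl hx.1.ne')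
    refine (h2.mul h1).congr_deriv ?_
    have h3 : inner ℝ (h x) ((x:ℂ) * h' x) = x * inner ℝ (h x) (h' x) := by
      rw [← Complex.real_smul, real_inner_smul_right]
    have h4 : x ^ (-2 * γ) = x ^ (-1 - 2 * γ) * x := by
      rw [← Real.rpow_add_one hx.1.ne']; congr 1; ring
    have h5 : x ^ (-2 * γ - 1) = x ^ (-1 - 2 * γ) := by congr 1; ring
    simp only [φ', h3, h4, h5]
    ring
  have hφ'i : IntegrableOn φ' (Ioc 0 1) := by
    refine (hi'.add (hi.const_mul (1 + 2 * |γ|))).mono' ?_ ?_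
    · refine ((continuousOn_rpow_Ioc _).mul (ContinuousOn.sub (continuousOn_const.mul
        (hhc.inner (𝕜 := ℝ) hxhc)) (continuousOn_const.mul (hhc.norm.pow 2)))).aestronglyMeasurable
        measurableSet_Ioc
    · refine (ae_restrict_iff' measurableSet_Ioc).2 (ae_of_all _ fun x hx => ?_)
      have hw := Real.rpow_pos_of_pos hx.1 (-1 - 2 * γ)
      have h1 := abs_real_inner_le_norm (h x) ((x:ℂ) * h' x)
      have h2 : |2 * inner ℝ (h x) ((x:ℂ) * h' x) - 2 * γ * ‖h x‖ ^ 2| ≤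
          ‖(x:ℂ) * h' x‖ ^ 2 + (1 + 2 * |γ|) * ‖h x‖ ^ 2 := by
        refine (abs_sub _ _).trans ?_
        rw [abs_mul, abs_mul, abs_mul, abs_of_nonneg (sq_nonneg ‖h x‖), abs_two]
        nlinarith [sq_nonneg (‖h x‖ - ‖(x:ℂ) * h' x‖)]
      rw [Real.norm_eq_abs, abs_mul, abs_of_pos hw]
      calc _ ≤ x ^ (-1 - 2 * γ) * (‖(x:ℂ) * h' x‖ ^ 2 + (1 + 2 * |γ|) * ‖h x‖ ^ 2) := by gcongr
        _ = _ := by simp only [Pi.add_apply]; ring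
  have hkey := integral_deriv_eq_of_integrable_div hφ
    (fun x hx => mul_nonneg (Real.rpow_nonneg hx.1.le _) (sq_nonneg _)) hφ'i (by
      refine hi.congr_fun (fun x hx => ?_) measurableSet_Ioc
      have h4 : x ^ (-2 * γ) = x ^ (-1 - 2 * γ) * x := by
        rw [← Real.rpow_add_one hx.1.ne']; congr 1; ring
      have := hx.1.ne'
      simp only [φ, h4]
      field_simp)
  have hmono : ∫ x : ℝ in Ioc (0:ℝ) 1, (γ - l) * φ' x ≤ ∫ x : ℝ in Ioc (0:ℝ) 1,
      (x ^ (-1 - 2 * γ) * ‖(x:ℂ) * h' x - l * h x‖ ^ 2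
        - (γ - l) ^ 2 * (x ^ (-1 - 2 * γ) * ‖h x‖ ^ 2)) := by
    refine setIntegral_mono_on (hφ'i.const_mul _) (hGi.sub (hi.const_mul _)) measurableSet_Ioc
      fun x hx => ?_
    have hw := Real.rpow_pos_of_pos hx.1 (-1 - 2 * γ)
    have h1 : (x:ℂ) * h' x = ((x:ℂ) * h' x - l * h x) + l • h x := by
      rw [Complex.real_smul]; ring
    have h2 : inner ℝ (h x) ((x:ℂ) * h' x) =
        inner ℝ (h x) ((x:ℂ) * h' x - l * h x) + l * ‖h x‖ ^ 2 := by
      conv_lhs => rw [h1]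
      rw [inner_add_right, real_inner_smul_right, real_inner_self_eq_norm_sq]
    have h3 := norm_sub_sq_real (((x:ℂ) * h' x - l * h x)) ((γ - l) • h x)
    rw [real_inner_smul_right, norm_smul, real_inner_comm, mul_pow, Real.norm_eq_abs, sq_abs] at h3
    simp only [φ', h2]
    have h4 := sq_nonneg ‖(x:ℂ) * h' x - l * h x - (γ - l) • h x‖
    rw [h3] at h4
    have := mul_nonneg hw.le h4
    linarith
  rw [integral_const_mul, hkey, integral_sub hGi (hi.const_mul _), integral_const_mul] at hmono
  simp only [φ, Real.one_rpow, one_mul] at hmono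
  linarith

theorem exists_mode_base_estimate {γ : ℝ} (hγ1 : 1/2 < γ) (hγ2 : γ < 1) :
    ∃ C : ℝ, 0 ≤ C ∧ ∀ (n : ℝ) (f f₁ f₂ g : ℝ → ℂ), 0 ≤ n →
      (n ≤ 2 ∨ 3 ≤ n ∧ f 1 = 0) →
      (∀ x ∈ Ioc (0:ℝ) 1, HasDerivAt f (f₁ x) x) →
      (∀ x ∈ Ioc (0:ℝ) 1, HasDerivAt f₁ (f₂ x) x) →
      (∀ x ∈ Ioc (0:ℝ) 1, (x:ℂ) ^ 2 * f₂ x + 2 * x * f₁ x + (1 - n ^ 2) / 4 * f x = g x) →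
      HasFiniteEnergy γ f → HasFiniteEnergy γ (fun x => (x:ℂ) * f₁ x) →
      HasFiniteEnergy γ (fun x => (x:ℂ) ^ 2 * f₂ x) →
      (1 + (n ^ 2) ^ 2) * weightedEnergy γ f ≤ C * weightedEnergy γ g ∧
      (1 + n ^ 2) * weightedEnergy γ (fun x => (x:ℂ) * f₁ x) ≤ C * weightedEnergy γ g := by
  obtain ⟨c, hc, hc1, hc2⟩ : ∃ c : ℝ, 0 < c ∧ c ≤ (γ - 1/2) / 3 ∧ c ≤ (1 - γ) / 4 :=
    ⟨min ((γ - 1/2) / 3) ((1 - γ) / 4), lt_min (by linarith) (by linarith),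
      min_le_left _ _, min_le_right _ _⟩
  refine ⟨8 + 4 / c ^ 2, by positivity, ?_⟩
  intro n f f₁ f₂ g hn hbc hd hd₁ hode h0 h1 h2
  set a : ℝ := (n - 1) / 2 with ha
  set b : ℝ := -(1 + n) / 2 with hb
  let h : ℝ → ℂ := fun x => (x:ℂ) * f₁ x - a * f x
  let h' : ℝ → ℂ := fun x => f₁ x + x * f₂ x - a * f₁ x
  have hh : ∀ x ∈ Ioc (0:ℝ) 1, HasDerivAt h (h' x) x := by
    intro x hx
    have := ((Complex.ofRealCLM.hasDerivAt (x := x)).mul (hd₁ x hx)).sub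
      ((hd x hx).const_mul (a:ℂ))
    refine this.congr_deriv ?_
    simp [h']
  have hhE : HasFiniteEnergy γ h := h0.euler h1 a
  have hh'E : HasFiniteEnergy γ (fun x => (x:ℂ) * h' x) := by
    refine (h2.add (h1.const_mul (1 - a))).congr fun x _ => ?_
    simp only [h']
    ring
  have hfac : weightedEnergy γ (fun x => (x:ℂ) * h' x - b * h x) = weightedEnergy γ g := by
    refine weightedEnergy_congr fun x hx => ?_
    rw [← hode x ⟨hx.1, hx.2.le⟩]
    simp only [h, h', ha, hb]
    push_cast
    ring
  have e1 := euler_first_order_estimate (l := b) hh hhE hh'E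
    (mul_nonneg (by rw [hb]; linarith) (sq_nonneg _))
  rw [hfac] at e1
  have hbd : 0 ≤ (γ - a) * ‖f 1‖ ^ 2 := by
    rcases hbc with h | ⟨-, h⟩
    · exact mul_nonneg (by rw [ha]; linarith) (sq_nonneg _)
    · simp [h]
  have e2 := euler_first_order_estimate (l := a) hd h0 h1 hbd
  change _ ≤ weightedEnergy γ h at e2
  have e3 : weightedEnergy γ (fun x => (x:ℂ) * f₁ x) ≤
      2 * weightedEnergy γ h + 2 * (a ^ 2 * weightedEnergy γ f) := by
    have := weightedEnergy_add_le hhE (h0.const_mul a)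
    rw [weightedEnergy_const_mul, Complex.norm_real, Real.norm_eq_abs, sq_abs] at this
    refine le_of_eq_of_le (weightedEnergy_congr fun x _ => ?_) this
    simp only [h]
    ring
  have hX := weightedEnergy_nonneg γ f
  have hY := weightedEnergy_nonneg γ g
  have hH := weightedEnergy_nonneg γ h
  set X := weightedEnergy γ f
  set Y := weightedEnergy γ g
  set H := weightedEnergy γ h
  set N := 1 + n with hN
  have hN1 : 1 ≤ N := by linarith
  have d1 : (N / 2) ^ 2 ≤ (γ - b) ^ 2 := by
    apply pow_le_pow_left₀ (by positivity)
    rw [hb]; linarith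
  have d2 : (c * N) ^ 2 ≤ (γ - a) ^ 2 := by
    rcases hbc with h | ⟨h, -⟩
    · apply pow_le_pow_left₀ (by positivity)
      have : c * N ≤ c * 3 := by gcongr; linarith
      rw [ha]; linarith
    · rw [← neg_sq (γ - a)]
      apply pow_le_pow_left₀ (by positivity)
      have : c * (n - 3) ≤ 1 / 4 * (n - 3) := by
        apply mul_le_mul_of_nonneg_right <;> linarith
      rw [ha]
      linarith [show c * N = c * 4 + c * (n - 3) by rw [hN]; ring]
  have e4 : N ^ 2 * H ≤ 4 * Y := by
    have := mul_le_mul_of_nonneg_right d1 hH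
    linarith
  have e5 : c ^ 2 * N ^ 2 * X ≤ H := by
    have := mul_le_mul_of_nonneg_right d2 hX
    linarith
  have e6 : N ^ 4 * X ≤ 4 / c ^ 2 * Y := by
    have : N ^ 2 * (c ^ 2 * N ^ 2 * X) ≤ N ^ 2 * H := by gcongr
    rw [div_mul_eq_mul_div, le_div_iff₀ (by positivity)]
    linarith
  have e7 : a ^ 2 ≤ N ^ 2 / 4 := by rw [ha, hN]; nlinarith
  constructor
  · have : 1 + (n ^ 2) ^ 2 ≤ N ^ 4 := by
      rw [hN]
      nlinarith [pow_nonneg hn 2, pow_nonneg hn 3]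
    have := mul_le_mul_of_nonneg_right this hX
    linarith
  · have h1 : 1 + n ^ 2 ≤ N ^ 2 := by rw [hN]; nlinarith
    have h2 := mul_le_mul_of_nonneg_right h1 (weightedEnergy_nonneg γ (fun x => (x:ℂ) * f₁ x))
    have h3 : N ^ 2 * weightedEnergy γ (fun x => (x:ℂ) * f₁ x) ≤
      N ^ 2 * (2 * H + 2 * (N ^ 2 / 4 * X)) := by
        gcongr
        exact e3.trans (by gcongr)
    have h4 : 0 ≤ 4 / c ^ 2 * Y := by positivity
    linarith

/-- Bounding a mixed sum of order `m` from bounds on its two lowest rows and a recursion. -/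
theorem exists_sum_le_of_recursion (m : ℕ) (hm : 2 ≤ m) {C : ℝ} (hC : 0 ≤ C) :
    ∃ K : ℝ, 0 ≤ K ∧ ∀ (κ : ℝ) (a b : ℕ → ℝ), 0 ≤ κ → (∀ p, 0 ≤ a p) → (∀ p, 0 ≤ b p) →
      (1 + κ ^ 2) * a 0 ≤ C * b 0 → (1 + κ) * a 1 ≤ C * b 0 →
      (∀ p, p + 2 ≤ m → a (p + 2) ≤ C * (b p + a (p + 1) + (1 + κ ^ 2) * a p)) →
      ∑ p ∈ Finset.range (m + 1), ∑ q ∈ Finset.range (m + 1 - p), κ ^ q * a p ≤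
        K * ∑ p ∈ Finset.range (m - 2 + 1), ∑ q ∈ Finset.range (m - 2 + 1 - p), κ ^ q * b p := by
  have key : ∀ p, ∃ K : ℝ, 0 ≤ K ∧ ∀ (κ : ℝ) (a b : ℕ → ℝ), 0 ≤ κ → (∀ p, 0 ≤ a p) →
      (∀ p, 0 ≤ b p) →
      (1 + κ ^ 2) * a 0 ≤ C * b 0 → (1 + κ) * a 1 ≤ C * b 0 →
      (∀ p, p + 2 ≤ m → a (p + 2) ≤ C * (b p + a (p + 1) + (1 + κ ^ 2) * a p)) →
      ∀ q, p + q ≤ m → κ ^ q * a p ≤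
        K * ∑ p ∈ Finset.range (m - 2 + 1), ∑ q ∈ Finset.range (m - 2 + 1 - p), κ ^ q * b p := by
    have term_le : ∀ (κ : ℝ) (b : ℕ → ℝ), 0 ≤ κ → (∀ p, 0 ≤ b p) → ∀ p q, p + q ≤ m - 2 →
        κ ^ q * b p ≤ ∑ p ∈ Finset.range (m - 2 + 1),
          ∑ q ∈ Finset.range (m - 2 + 1 - p), κ ^ q * b p := by
      intro κ b hκ hb p q hpq
      refine le_trans ?_ (Finset.single_le_sum (f := fun p =>
        ∑ q ∈ Finset.range (m - 2 + 1 - p), κ ^ q * b p)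
        (fun p _ => Finset.sum_nonneg fun q _ => mul_nonneg (pow_nonneg hκ q) (hb p))
        (Finset.mem_range.2 (by omega : p < m - 2 + 1)))
      exact Finset.single_le_sum (f := fun q => κ ^ q * b p)
        (fun q _ => mul_nonneg (pow_nonneg hκ q) (hb p)) (Finset.mem_range.2 (by omega))
    intro p
    induction p using Nat.strong_induction_on with
    | _ p ih =>
    match p with
    | 0 =>
      refine ⟨C, hC, fun κ a b hκ ha hb h0 _ _ q hq => ?_⟩
      have ha0 := ha 0
      have hκa := mul_nonneg (sq_nonneg κ) ha0
      match q with
      | 0 =>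
        have := mul_le_mul_of_nonneg_left (term_le κ b hκ hb 0 0 (by omega)) hC
        simp only [pow_zero, one_mul] at this ⊢
        linarith
      | 1 =>
        have := mul_le_mul_of_nonneg_left (term_le κ b hκ hb 0 0 (by omega)) hC
        simp only [pow_zero, one_mul] at this
        have h2 : κ * a 0 ≤ (1 + κ ^ 2) * a 0 := by
          gcongr
          nlinarith
        rw [pow_one]
        linarith
      | q + 2 =>
        have := mul_le_mul_of_nonneg_left (term_le κ b hκ hb 0 q (by omega)) hC
        have h2 : κ ^ q * (κ ^ 2 * a 0) ≤ κ ^ q * (C * b 0) :=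
          mul_le_mul_of_nonneg_left (by linarith) (pow_nonneg hκ q)
        rw [pow_add]
        linarith
    | 1 =>
      refine ⟨C, hC, fun κ a b hκ ha hb _ h1 _ q hq => ?_⟩
      have ha1 := ha 1
      have hκa := mul_nonneg hκ ha1
      match q with
      | 0 =>
        have := mul_le_mul_of_nonneg_left (term_le κ b hκ hb 0 0 (by omega)) hC
        simp only [pow_zero, one_mul] at this ⊢
        linarith
      | q + 1 =>
        have := mul_le_mul_of_nonneg_left (term_le κ b hκ hb 0 q (by omega)) hC
        have h2 : κ ^ q * (κ * a 1) ≤ κ ^ q * (C * b 0) :=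
          mul_le_mul_of_nonneg_left (by linarith) (pow_nonneg hκ q)
        rw [pow_add, pow_one]
        linarith
    | p + 2 =>
      obtain ⟨K₀, hK₀, h₀⟩ := ih p (by omega)
      obtain ⟨K₁, hK₁, h₁⟩ := ih (p + 1) (by omega)
      refine ⟨C * (1 + K₁ + 2 * K₀), by positivity, fun κ a b hκ ha hb ha0 ha1 hrec q hq => ?_⟩
      have t := term_le κ b hκ hb p q (by omega)
      have t1 := h₁ κ a b hκ ha hb ha0 ha1 hrec q (by omega)
      have t0 := h₀ κ a b hκ ha hb ha0 ha1 hrec q (by omega)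
      have t2 := h₀ κ a b hκ ha hb ha0 ha1 hrec (q + 2) (by omega)
      have t3 := mul_le_mul_of_nonneg_left (hrec p (by omega)) (pow_nonneg hκ q)
      have t4 := mul_le_mul_of_nonneg_left (add_le_add (add_le_add t t1) (add_le_add t0 t2)) hC
      rw [pow_add] at t4
      linarith
  choose K hK hKle using key
  refine ⟨∑ p ∈ Finset.range (m + 1), ∑ _q ∈ Finset.range (m + 1 - p), K p,
    Finset.sum_nonneg fun p _ => Finset.sum_nonneg fun _ _ => hK p, ?_⟩
  intro κ a b hκ ha hb h0 h1 hrec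
  rw [Finset.sum_mul]
  refine Finset.sum_le_sum fun p hp => ?_
  rw [Finset.sum_mul]
  refine Finset.sum_le_sum fun q hq => ?_
  rw [Finset.mem_range] at hp hq
  exact hKle p κ a b hκ ha hb h0 h1 hrec q (by omega)

theorem contDiffOn_iteratedDeriv {f : ℝ → ℂ} {s : Set ℝ} (hs : IsOpen s)
    (hf : ContDiffOn ℝ (⊤ : ℕ∞) f s) (p : ℕ) : ContDiffOn ℝ (⊤ : ℕ∞) (iteratedDeriv p f) s := by
  induction p with
  | zero => simpa using hf
  | succ p ih =>
    rw [iteratedDeriv_succ]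
    exact ((contDiffOn_infty_iff_deriv_of_isOpen hs).1 ih).2

theorem ContDiffOn.hasDerivAt_iteratedDeriv {f : ℝ → ℂ} {s : Set ℝ} (hs : IsOpen s)
    (hf : ContDiffOn ℝ (⊤ : ℕ∞) f s) (p : ℕ) {x : ℝ} (hx : x ∈ s) :
    HasDerivAt (iteratedDeriv p f) (iteratedDeriv (p + 1) f x) x := by
  rw [iteratedDeriv_succ]
  exact (((contDiffOn_iteratedDeriv hs hf p).differentiableOn (by simp)).differentiableAt
    (hs.mem_nhds hx)).hasDerivAt

/-- The scale-invariant derivative `xᵖ Dᵖ f`. -/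
def scaledDeriv (p : ℕ) (f : ℝ → ℂ) (x : ℝ) : ℂ := (x:ℂ) ^ p * iteratedDeriv p f x

theorem ContDiffOn.continuousOn_scaledDeriv {f : ℝ → ℂ}
    (hf : ContDiffOn ℝ (⊤ : ℕ∞) f (Ioi 0)) (p : ℕ) : ContinuousOn (scaledDeriv p f) (Ioc 0 1) :=
  (Complex.continuous_ofReal.pow p).continuousOn.mul fun _ hx =>
    (hf.hasDerivAt_iteratedDeriv isOpen_Ioi p hx.1).continuousAt.continuousWithinAt

theorem euler_equation_iteratedDeriv {f g : ℝ → ℂ} (hf : ContDiffOn ℝ (⊤ : ℕ∞) f (Ioi 0)) {c : ℂ}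
    (hode : ∀ x ∈ Ioo (0:ℝ) 1, (x:ℂ) ^ 2 * iteratedDeriv 2 f x + 2 * x * iteratedDeriv 1 f x
      + c * f x = g x) (p : ℕ) :
    ∀ x ∈ Ioo (0:ℝ) 1, (x:ℂ) ^ 2 * iteratedDeriv (p + 2) f x
      + (2 * p + 2) * x * iteratedDeriv (p + 1) f x + (p ^ 2 + p + c) * iteratedDeriv p f x =
        iteratedDeriv p g x := by
  induction p with
  | zero =>
    intro x hx
    have := hode x hx
    simpa using this
  | succ p ih =>
    intro x hx
    have hd := fun p => hf.hasDerivAt_iteratedDeriv isOpen_Ioi p hx.1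
    have hX : HasDerivAt (fun x : ℝ => (x:ℂ)) 1 x := Complex.ofRealCLM.hasDerivAt
    have h1 := (((hX.pow 2).mul (hd (p + 2))).add
      ((hX.const_mul (2 * p + 2 : ℂ)).mul (hd (p + 1)))).add
      ((hd p).const_mul (p ^ 2 + p + c : ℂ))
    have h2 := (h1.congr_of_eventuallyEq (f₁ := iteratedDeriv p g) (by
      filter_upwards [isOpen_Ioo.mem_nhds hx] with y hy using (ih y hy).symm)).deriv
    rw [iteratedDeriv_succ (f := g), h2]
    push_cast
    simp only [Pi.pow_apply]
    ring

theorem exists_mode_estimate (m : ℕ) (hm : 2 ≤ m) {γ : ℝ} (hγ1 : 1/2 < γ) (hγ2 : γ < 1) :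
    ∃ C : ℝ, 0 ≤ C ∧ ∀ (k : ℤ) (f g : ℝ → ℂ), ContDiffOn ℝ (⊤ : ℕ∞) f (Ioi 0) →
      (∀ x ∈ Ioc (0:ℝ) 1, (x:ℂ) ^ 2 * iteratedDeriv 2 f x + 2 * x * iteratedDeriv 1 f x
        + (1 - (k:ℂ) ^ 2) / 4 * f x = g x) →
      (3 ≤ |k| → f 1 = 0) →
      (∀ p ≤ m, HasFiniteEnergy γ (scaledDeriv p f)) →
      (∀ p ≤ m - 2, HasFiniteEnergy γ (scaledDeriv p g)) →
      ∑ p ∈ Finset.range (m + 1), ∑ q ∈ Finset.range (m + 1 - p),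
        (k:ℝ) ^ (2 * q) * weightedEnergy γ (scaledDeriv p f) ≤
      C * ∑ p ∈ Finset.range (m - 2 + 1), ∑ q ∈ Finset.range (m - 2 + 1 - p),
        (k:ℝ) ^ (2 * q) * weightedEnergy γ (scaledDeriv p g) := by
  obtain ⟨C₀, hC₀, hbase⟩ := exists_mode_base_estimate hγ1 hγ2
  set C₁ : ℝ := 2 + 4 * (2 * m + 2) ^ 2 + 8 * (m ^ 2 + m + 1) ^ 2 with hC₁
  have hC₁0 : 0 ≤ C₁ := by positivity
  obtain ⟨K, hK, hsum⟩ := exists_sum_le_of_recursion m hm (add_nonneg hC₀ hC₁0)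
  refine ⟨K, hK, fun k f g hf hode hbc hfE hgE => ?_⟩
  simp only [pow_mul]
  have hg0 : 0 ≤ weightedEnergy γ (scaledDeriv 0 g) := weightedEnergy_nonneg _ _
  have hk : (|k| : ℝ) ^ 2 = (k:ℝ) ^ 2 := sq_abs _
  have e0 : scaledDeriv 0 f = f := by ext; simp [scaledDeriv]
  have eg : scaledDeriv 0 g = g := by ext; simp [scaledDeriv]
  have e1 : scaledDeriv 1 f = fun x : ℝ => (x:ℂ) * iteratedDeriv 1 f x := by ext; simp [scaledDeriv]
  have hb := hbase |(k:ℝ)| f (iteratedDeriv 1 f) (iteratedDeriv 2 f) g (abs_nonneg _) (by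
      rcases le_or_gt 3 |k| with h | h
      · exact Or.inr ⟨by exact_mod_cast h, hbc h⟩
      · exact Or.inl (by exact_mod_cast (by omega : |k| ≤ 2)))
    (fun x hx => by
      have := hf.hasDerivAt_iteratedDeriv isOpen_Ioi 0 hx.1
      rwa [iteratedDeriv_zero] at this)
    (fun x hx => hf.hasDerivAt_iteratedDeriv isOpen_Ioi 1 hx.1)
    (fun x hx => by
      rw [← hode x hx, ← Complex.ofReal_pow |(k:ℝ)|, hk]
      push_cast
      ring)
    (e0 ▸ hfE 0 (by omega)) (e1 ▸ hfE 1 (by omega)) (hfE 2 hm)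
  rw [hk] at hb
  refine hsum ((k:ℝ) ^ 2) (fun p => weightedEnergy γ (scaledDeriv p f))
    (fun p => weightedEnergy γ (scaledDeriv p g)) (sq_nonneg _)
    (fun p => weightedEnergy_nonneg _ _) (fun p => weightedEnergy_nonneg _ _) ?_ ?_ ?_
  · simp only [e0, eg] at hg0 ⊢
    nlinarith [hb.1]
  · simp only [e1, eg] at hg0 ⊢
    nlinarith [hb.2]
  · intro p hp
    have hE : weightedEnergy γ (scaledDeriv (p + 2) f) = weightedEnergy γ (fun x =>
        scaledDeriv p g x + ((-(2 * p + 2 : ℝ) : ℝ) * scaledDeriv (p + 1) f x +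
          (-(p ^ 2 + p + (1 - (k:ℝ) ^ 2) / 4 : ℝ) : ℝ) * scaledDeriv p f x)) := by
      refine weightedEnergy_congr fun x hx => ?_
      have := euler_equation_iteratedDeriv hf (fun x hx => hode x ⟨hx.1, hx.2.le⟩) p x hx
      simp only [scaledDeriv, ← this]
      push_cast
      ring
    have hg := hgE p (by omega)
    have hf1 := (hfE (p + 1) (by omega)).const_mul (-(2 * p + 2 : ℝ) : ℝ)
    have hf0 := (hfE p (by omega)).const_mul (-(p ^ 2 + p + (1 - (k:ℝ) ^ 2) / 4 : ℝ) : ℝ)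
    have i1 := weightedEnergy_add_le hg (hf1.add hf0)
    have i2 := weightedEnergy_add_le hf1 hf0
    rw [weightedEnergy_const_mul, weightedEnergy_const_mul, Complex.norm_real, Complex.norm_real,
      Real.norm_eq_abs, Real.norm_eq_abs, sq_abs, sq_abs, neg_sq, neg_sq] at i2
    rw [← hE] at i1
    have hpm : (p:ℝ) ≤ m := by exact_mod_cast (by omega : p ≤ m)
    have hp0 : (0:ℝ) ≤ p := p.cast_nonneg
    have c1 : (2 * (p:ℝ) + 2) ^ 2 ≤ (2 * m + 2) ^ 2 := by gcongr
    have c2 : (p ^ 2 + p + (1 - (k:ℝ) ^ 2) / 4) ^ 2 ≤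
        2 * (m ^ 2 + m + 1) ^ 2 * (1 + ((k:ℝ) ^ 2) ^ 2) := by
      have s1 : ((p:ℝ) ^ 2 + p + 1 / 4) ^ 2 ≤ (m ^ 2 + m + 1) ^ 2 := by
        gcongr
        norm_num
      have s2 : (1:ℝ) ≤ (m ^ 2 + m + 1) ^ 2 := one_le_pow₀ (by nlinarith)
      have s3 := mul_le_mul_of_nonneg_right s2 (sq_nonneg ((k:ℝ) ^ 2))
      nlinarith [sq_nonneg ((p:ℝ) ^ 2 + p + 1 / 4 + (k:ℝ) ^ 2 / 4), sq_nonneg ((k:ℝ) ^ 2)]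
    have a0 := weightedEnergy_nonneg γ (scaledDeriv p f)
    have a1 := weightedEnergy_nonneg γ (scaledDeriv (p + 1) f)
    have b0 := weightedEnergy_nonneg γ (scaledDeriv p g)
    have t1 := mul_le_mul_of_nonneg_right c1 a1
    have t2 := mul_le_mul_of_nonneg_right c2 a0
    have hA : 2 ≤ C₀ + C₁ := by
      have : 0 ≤ 4 * (2 * (m:ℝ) + 2) ^ 2 + 8 * (m ^ 2 + m + 1) ^ 2 := by positivity
      linarith
    have hB : 4 * (2 * (m:ℝ) + 2) ^ 2 ≤ C₀ + C₁ := by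
      have : 0 ≤ 8 * ((m:ℝ) ^ 2 + m + 1) ^ 2 := by positivity
      linarith
    have hD : 8 * ((m:ℝ) ^ 2 + m + 1) ^ 2 ≤ C₀ + C₁ := by
      have : 0 ≤ 4 * (2 * (m:ℝ) + 2) ^ 2 := by positivity
      linarith
    have u0 := mul_le_mul_of_nonneg_right hA b0
    have u1 := mul_le_mul_of_nonneg_right hB a1
    have u2 := mul_le_mul_of_nonneg_right hD
      (mul_nonneg (by positivity : 0 ≤ 1 + ((k:ℝ) ^ 2) ^ 2) a0)
    linarith

theorem isOpen_halfPlane : IsOpen (Ioi (0:ℝ) ×ˢ (univ : Set ℝ)) := isOpen_Ioi.prod isOpen_univ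

theorem hasDerivAt_radial {u : ℝ → ℝ → ℂ}
    (hu : ContDiffOn ℝ (⊤ : ℕ∞) (Function.uncurry u) (Ioi (0:ℝ) ×ˢ (univ : Set ℝ)))
    {ψ : ℝ} (hψ : 0 < ψ) (θ : ℝ) :
    HasDerivAt (fun s => u s θ) (fderiv ℝ (Function.uncurry u) (ψ, θ) (1, 0)) ψ := by
  have h1 : HasFDerivAt (Function.uncurry u) (fderiv ℝ (Function.uncurry u) (ψ, θ)) (ψ, θ) :=
    ((hu.contDiffAt (isOpen_halfPlane.mem_nhds ⟨mem_Ioi.2 hψ, mem_univ _⟩)).differentiableAt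
      (by simp)).hasFDerivAt
  exact h1.comp_hasDerivAt ψ ((hasDerivAt_id ψ).prodMk (hasDerivAt_const ψ θ))

theorem hasDerivAt_angular {u : ℝ → ℝ → ℂ}
    (hu : ContDiffOn ℝ (⊤ : ℕ∞) (Function.uncurry u) (Ioi (0:ℝ) ×ˢ (univ : Set ℝ)))
    {ψ : ℝ} (hψ : 0 < ψ) (θ : ℝ) :
    HasDerivAt (u ψ) (fderiv ℝ (Function.uncurry u) (ψ, θ) (0, 1)) θ := by
  have h1 : HasFDerivAt (Function.uncurry u) (fderiv ℝ (Function.uncurry u) (ψ, θ)) (ψ, θ) :=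
    ((hu.contDiffAt (isOpen_halfPlane.mem_nhds ⟨mem_Ioi.2 hψ, mem_univ _⟩)).differentiableAt
      (by simp)).hasFDerivAt
  exact h1.comp_hasDerivAt θ ((hasDerivAt_const θ ψ).prodMk (hasDerivAt_id θ))

theorem contDiffOn_fderiv_apply {u : ℝ → ℝ → ℂ}
    (hu : ContDiffOn ℝ (⊤ : ℕ∞) (Function.uncurry u) (Ioi (0:ℝ) ×ˢ (univ : Set ℝ))) (v : ℝ × ℝ) :
    ContDiffOn ℝ (⊤ : ℕ∞) (fun z => fderiv ℝ (Function.uncurry u) z v)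
      (Ioi (0:ℝ) ×ˢ (univ : Set ℝ)) :=
  (hu.fderiv_of_isOpen isOpen_halfPlane (by simp)).clm_apply contDiffOn_const

theorem contDiffOn_radial_deriv {u : ℝ → ℝ → ℂ}
    (hu : ContDiffOn ℝ (⊤ : ℕ∞) (Function.uncurry u) (Ioi (0:ℝ) ×ˢ (univ : Set ℝ))) :
    ContDiffOn ℝ (⊤ : ℕ∞) (Function.uncurry fun ψ θ => deriv (fun s => u s θ) ψ)
      (Ioi (0:ℝ) ×ˢ (univ : Set ℝ)) :=
  (contDiffOn_fderiv_apply hu (1, 0)).congr fun z hz => (hasDerivAt_radial hu hz.1 z.2).deriv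

theorem contDiffOn_angular_deriv {u : ℝ → ℝ → ℂ}
    (hu : ContDiffOn ℝ (⊤ : ℕ∞) (Function.uncurry u) (Ioi (0:ℝ) ×ˢ (univ : Set ℝ))) :
    ContDiffOn ℝ (⊤ : ℕ∞) (Function.uncurry fun ψ θ => deriv (u ψ) θ)
      (Ioi (0:ℝ) ×ˢ (univ : Set ℝ)) :=
  (contDiffOn_fderiv_apply hu (0, 1)).congr fun z hz => (hasDerivAt_angular hu hz.1 z.2).deriv

theorem continuous_slice {u : ℝ → ℝ → ℂ}
    (hu : ContinuousOn (Function.uncurry u) (Ioi (0:ℝ) ×ˢ (univ : Set ℝ))) {ψ : ℝ} (hψ : 0 < ψ) :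
    Continuous (u ψ) :=
  hu.comp_continuous (f := fun θ => (ψ, θ)) (by fun_prop) fun _ => ⟨hψ, mem_univ _⟩

theorem hasDerivAt_fourierCoefAnn {u : ℝ → ℝ → ℂ}
    (hu : ContDiffOn ℝ (⊤ : ℕ∞) (Function.uncurry u) (Ioi (0:ℝ) ×ˢ (univ : Set ℝ))) (k : ℤ)
    {ψ : ℝ} (hψ : 0 < ψ) :
    HasDerivAt (fourierCoefAnn u k)
      (fourierCoefAnn (fun ψ θ => deriv (fun s => u s θ) ψ) k ψ) ψ := by
  have hu' := (contDiffOn_radial_deriv hu).continuousOn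
  have hcomp : IsCompact (Icc (ψ / 2) (ψ + 1) ×ˢ Icc (0:ℝ) (2 * π)) :=
    isCompact_Icc.prod isCompact_Icc
  have hpos : ∀ s ∈ Icc (ψ / 2) (ψ + 1), 0 < s := fun s hs => by linarith [hs.1]
  obtain ⟨M, hM⟩ := hcomp.exists_bound_of_continuousOn
    (hu'.mono fun z hz => ⟨hpos z.1 hz.1, mem_univ _⟩)
  have hexp : Continuous fun θ : ℝ => Complex.exp (-(k:ℂ) * Complex.I * (θ:ℂ)) := by fun_prop
  have hI : Icc (ψ / 2) (ψ + 1) ∈ 𝓝 ψ := Icc_mem_nhds (by linarith) (by linarith)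
  refine HasDerivAt.const_mul _ (intervalIntegral.hasDerivAt_integral_of_dominated_loc_of_deriv_le
    (F := fun s θ => u s θ * Complex.exp (-(k:ℂ) * Complex.I * (θ:ℂ)))
    (F' := fun s θ => deriv (fun r => u r θ) s * Complex.exp (-(k:ℂ) * Complex.I * (θ:ℂ)))
    (a := 0) (b := 2 * π) (μ := volume) (bound := fun _ => M) (s := Icc (ψ / 2) (ψ + 1))
    hI ?_ ?_ ?_ ?_ ?_ ?_).2
  · filter_upwards [hI] with s hs
    exact ((continuous_slice hu.continuousOn (hpos s hs)).mul hexp).aestronglyMeasurable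
  · exact ((continuous_slice hu.continuousOn hψ).mul hexp).intervalIntegrable _ _
  · exact ((continuous_slice hu' hψ).mul hexp).aestronglyMeasurable
  · refine ae_of_all _ fun θ hθ s hs => ?_
    rw [uIoc_of_le two_pi_pos.le] at hθ
    have h1 : ‖Complex.exp (-(k:ℂ) * Complex.I * (θ:ℂ))‖ = 1 := by
      rw [show -(k:ℂ) * Complex.I * (θ:ℂ) = ((-(k:ℝ) * θ : ℝ) : ℂ) * Complex.I by push_cast; ring]
      exact Complex.norm_exp_ofReal_mul_I _
    rw [norm_mul, h1, mul_one]
    exact hM (s, θ) ⟨hs, hθ.1.le, hθ.2⟩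
  · exact intervalIntegrable_const
  · exact ae_of_all _ fun θ _ s hs =>
      (hasDerivAt_radial hu (hpos s hs) θ).differentiableAt.hasDerivAt.mul_const _

theorem contDiffOn_fourierCoefAnn {u : ℝ → ℝ → ℂ}
    (hu : ContDiffOn ℝ (⊤ : ℕ∞) (Function.uncurry u) (Ioi (0:ℝ) ×ˢ (univ : Set ℝ))) (k : ℤ) :
    ContDiffOn ℝ (⊤ : ℕ∞) (fourierCoefAnn u k) (Ioi 0) := by
  rw [contDiffOn_infty]
  intro n
  induction n generalizing u with
  | zero =>
    exact contDiffOn_zero.2 fun x hx =>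
      (hasDerivAt_fourierCoefAnn hu k hx).continuousAt.continuousWithinAt
  | succ n ih =>
    rw [Nat.cast_succ, contDiffOn_succ_iff_deriv_of_isOpen isOpen_Ioi]
    refine ⟨fun x hx =>
      (hasDerivAt_fourierCoefAnn hu k hx).differentiableAt.differentiableWithinAt, by simp, ?_⟩
    exact (ih (contDiffOn_radial_deriv hu)).congr fun x hx =>
      (hasDerivAt_fourierCoefAnn hu k hx).deriv

theorem fourierCoefAnn_angular_deriv {u : ℝ → ℝ → ℂ} (hu : SmoothAnn u) (k : ℤ)
    {ψ : ℝ} (hψ : 0 < ψ) :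
    fourierCoefAnn (fun ψ θ => deriv (u ψ) θ) k ψ = k * Complex.I * fourierCoefAnn u k ψ := by
  have hexp : ∀ θ : ℝ, HasDerivAt (fun θ : ℝ => Complex.exp (-(k:ℂ) * Complex.I * (θ:ℂ)))
      (Complex.exp (-(k:ℂ) * Complex.I * (θ:ℂ)) * (-(k:ℂ) * Complex.I)) θ := by
    intro θ
    have h1 : HasDerivAt (fun θ : ℝ => (θ:ℂ)) 1 θ := Complex.ofRealCLM.hasDerivAt
    simpa using (h1.const_mul (-(k:ℂ) * Complex.I)).cexp
  have hcexp : Continuous fun θ : ℝ => Complex.exp (-(k:ℂ) * Complex.I * (θ:ℂ)) := by fun_prop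
  have hd : Continuous (deriv (u ψ)) :=
    continuous_slice (contDiffOn_angular_deriv hu.1).continuousOn hψ
  have h := intervalIntegral.integral_deriv_mul_eq_sub (a := 0) (b := 2 * π)
    (fun θ _ => (hasDerivAt_angular hu.1 hψ θ).differentiableAt.hasDerivAt) (fun θ _ => hexp θ)
    (hd.intervalIntegrable _ _) ((hcexp.mul continuous_const).intervalIntegrable _ _)
  have hper : u ψ (2 * π) = u ψ 0 := by simpa using hu.2 ψ 0
  have hexp1 : Complex.exp (-(k:ℂ) * Complex.I * ((2 * π : ℝ):ℂ)) = 1 := by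
    rw [Complex.exp_eq_one_iff]
    exact ⟨-k, by push_cast; ring⟩
  have i1 : IntervalIntegrable
      (fun θ : ℝ => deriv (u ψ) θ * Complex.exp (-(k:ℂ) * Complex.I * (θ:ℂ))) volume 0 (2 * π) :=
    (hd.mul hcexp).intervalIntegrable _ _
  have i2 : IntervalIntegrable (fun θ : ℝ => u ψ θ * (Complex.exp (-(k:ℂ) * Complex.I * (θ:ℂ))
      * (-(k:ℂ) * Complex.I))) volume 0 (2 * π) :=
    ((continuous_slice hu.1.continuousOn hψ).mul
      (hcexp.mul continuous_const)).intervalIntegrable _ _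
  rw [hper, hexp1, intervalIntegral.integral_add i1 i2] at h
  simp only [← mul_assoc, intervalIntegral.integral_mul_const] at h
  simp only [Complex.ofReal_zero, mul_zero, Complex.exp_zero, sub_self] at h
  simp only [fourierCoefAnn]
  linear_combination (1 / (2 * π) : ℂ) * h

theorem SmoothAnn.angular_deriv {u : ℝ → ℝ → ℂ} (hu : SmoothAnn u) :
    SmoothAnn (fun ψ θ => deriv (u ψ) θ) := by
  refine ⟨contDiffOn_angular_deriv hu.1, fun ψ θ => ?_⟩
  have h : (fun t => u ψ (t + 2 * π)) = u ψ := funext fun t => hu.2 ψ t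
  change deriv (u ψ) (θ + 2 * π) = deriv (u ψ) θ
  rw [← deriv_comp_add_const (u ψ) (2 * π) θ, h]

theorem pder_zero_zero (u : ℝ → ℝ → ℂ) : pder 0 0 u = u := by
  ext
  simp [pder]

theorem pder_succ_zero (p : ℕ) (u : ℝ → ℝ → ℂ) :
    pder (p + 1) 0 u = pder p 0 fun ψ θ => deriv (fun s => u s θ) ψ := by
  ext ψ θ
  simp only [pder, iteratedDeriv_zero, iteratedDeriv_succ']

theorem pder_zero_two (u : ℝ → ℝ → ℂ) :
    pder 0 2 u = fun ψ θ => deriv (fun t => deriv (u ψ) t) θ := by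
  ext ψ θ
  simp [pder, iteratedDeriv_succ']

theorem iteratedDeriv_fourierCoefAnn {u : ℝ → ℝ → ℂ}
    (hu : ContDiffOn ℝ (⊤ : ℕ∞) (Function.uncurry u) (Ioi (0:ℝ) ×ˢ (univ : Set ℝ))) (k : ℤ) (p : ℕ)
    {ψ : ℝ} (hψ : 0 < ψ) :
    iteratedDeriv p (fourierCoefAnn u k) ψ = fourierCoefAnn (pder p 0 u) k ψ := by
  induction p generalizing u ψ with
  | zero => rw [pder_zero_zero, iteratedDeriv_zero]
  | succ p ih =>
    have h : iteratedDeriv p (deriv (fourierCoefAnn u k)) ψ =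
        iteratedDeriv p (fourierCoefAnn (fun ψ θ => deriv (fun s => u s θ) ψ) k) ψ := by
      refine Filter.EventuallyEq.iteratedDeriv_eq p ?_
      filter_upwards [isOpen_Ioi.mem_nhds hψ] with x hx
        using (hasDerivAt_fourierCoefAnn hu k hx).deriv
    rw [iteratedDeriv_succ', h, ih (contDiffOn_radial_deriv hu) hψ, pder_succ_zero]

theorem continuousOn_pder_radial {u : ℝ → ℝ → ℂ}
    (hu : ContDiffOn ℝ (⊤ : ℕ∞) (Function.uncurry u) (Ioi (0:ℝ) ×ˢ (univ : Set ℝ))) (p : ℕ) :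
    ContinuousOn (Function.uncurry (pder p 0 u)) (Ioi (0:ℝ) ×ˢ (univ : Set ℝ)) := by
  induction p generalizing u with
  | zero => exact (pder_zero_zero u).symm ▸ hu.continuousOn
  | succ p ih => exact (pder_succ_zero p u).symm ▸ ih (contDiffOn_radial_deriv hu)

/-- Each Fourier coefficient of a solution solves an Euler ordinary differential equation. -/
theorem fourierCoefAnn_ode {w η : ℝ → ℝ → ℂ} (hw : SmoothAnn w)
    (heq : ∀ ψ ∈ Ioc (0:ℝ) 1, ∀ θ : ℝ,
        (ψ:ℂ)^2 * pder 2 0 w ψ θ + 2*(ψ:ℂ) * pder 1 0 w ψ θ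
          + (1/4) * (w ψ θ + pder 0 2 w ψ θ) = η ψ θ) (k : ℤ) {x : ℝ} (hx : x ∈ Ioc (0:ℝ) 1) :
    (x:ℂ) ^ 2 * iteratedDeriv 2 (fourierCoefAnn w k) x
      + 2 * x * iteratedDeriv 1 (fourierCoefAnn w k) x
      + (1 - (k:ℂ) ^ 2) / 4 * fourierCoefAnn w k x = fourierCoefAnn η k x := by
  have hcexp : Continuous fun θ : ℝ => Complex.exp (-(k:ℂ) * Complex.I * (θ:ℂ)) := by fun_prop
  have h2 : fourierCoefAnn (pder 0 2 w) k x = -(k:ℂ) ^ 2 * fourierCoefAnn w k x := by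
    rw [pder_zero_two, fourierCoefAnn_angular_deriv hw.angular_deriv k hx.1,
      fourierCoefAnn_angular_deriv hw k hx.1]
    linear_combination (k:ℂ) ^ 2 * fourierCoefAnn w k x * Complex.I_sq
  have hc02 : Continuous (pder 0 2 w x) := by
    rw [pder_zero_two]
    exact continuous_slice (contDiffOn_angular_deriv hw.angular_deriv.1).continuousOn hx.1
  have h_int : ∀ f : ℝ → ℂ, Continuous f → IntervalIntegrable
      (fun θ : ℝ => f θ * Complex.exp (-(k:ℂ) * Complex.I * (θ:ℂ))) volume 0 (2 * π) :=
    fun f hf => (hf.mul hcexp).intervalIntegrable _ _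
  have i20 := (h_int _ (continuous_slice (continuousOn_pder_radial hw.1 2) hx.1)).const_mul
    ((x:ℂ) ^ 2)
  have i10 := (h_int _ (continuous_slice (continuousOn_pder_radial hw.1 1) hx.1)).const_mul
    (2 * (x:ℂ))
  have i00 := h_int _ (continuous_slice hw.1.continuousOn hx.1)
  have i02 := h_int _ hc02
  have hη : fourierCoefAnn η k x = (x:ℂ) ^ 2 * fourierCoefAnn (pder 2 0 w) k x
      + 2 * x * fourierCoefAnn (pder 1 0 w) k x
      + 1 / 4 * (fourierCoefAnn w k x + fourierCoefAnn (pder 0 2 w) k x) := by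
    have : ∀ θ : ℝ, η x θ * Complex.exp (-(k:ℂ) * Complex.I * (θ:ℂ)) =
        (x:ℂ) ^ 2 * (pder 2 0 w x θ * Complex.exp (-(k:ℂ) * Complex.I * (θ:ℂ)))
        + 2 * x * (pder 1 0 w x θ * Complex.exp (-(k:ℂ) * Complex.I * (θ:ℂ)))
        + 1 / 4 * (w x θ * Complex.exp (-(k:ℂ) * Complex.I * (θ:ℂ))
          + pder 0 2 w x θ * Complex.exp (-(k:ℂ) * Complex.I * (θ:ℂ))) := by
      intro θ
      rw [← heq x hx θ]
      ring
    simp only [fourierCoefAnn, this]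
    rw [intervalIntegral.integral_add (i20.add i10) ((i00.add i02).const_mul _),
      intervalIntegral.integral_add i20 i10, intervalIntegral.integral_const_mul,
      intervalIntegral.integral_const_mul, intervalIntegral.integral_const_mul,
      intervalIntegral.integral_add i00 i02]
    ring
  rw [hη, h2, iteratedDeriv_fourierCoefAnn hw.1 k 2 hx.1,
    iteratedDeriv_fourierCoefAnn hw.1 k 1 hx.1]
  ring

theorem lintegral_kondratev_eq (γ : ℝ) (f : ℝ → ℂ) (p : ℕ) :
    ∫⁻ ψ in Ioc (0:ℝ) 1, ENNReal.ofReal (ψ ^ (2*((p:ℝ) - 1/2 - γ)) * ‖iteratedDeriv p f ψ‖^2)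
      = ∫⁻ x in Ioc (0:ℝ) 1, ENNReal.ofReal (x ^ (-1 - 2 * γ) * ‖scaledDeriv p f x‖ ^ 2) := by
  refine setLIntegral_congr_fun measurableSet_Ioc fun x hx => ?_
  have h : x ^ (2 * ((p:ℝ) - 1 / 2 - γ)) = x ^ (-1 - 2 * γ) * (x ^ p) ^ 2 := by
    rw [← pow_mul, ← Real.rpow_natCast, ← Real.rpow_add hx.1]
    congr 1
    push_cast
    ring
  simp only [scaledDeriv, norm_mul, norm_pow, Complex.norm_of_nonneg hx.1.le]
  rw [h]
  congr 1
  ring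

theorem hasFiniteEnergy_of_lintegral_ne_top {γ : ℝ} {u : ℝ → ℂ} (hc : ContinuousOn u (Ioc 0 1))
    (h : ∫⁻ x in Ioc (0:ℝ) 1, ENNReal.ofReal (x ^ (-1 - 2 * γ) * ‖u x‖ ^ 2) ≠ ⊤) :
    HasFiniteEnergy γ u := by
  refine ⟨hc, ?_⟩
  have hm : ContinuousOn (fun x : ℝ => x ^ (-1 - 2 * γ) * ‖u x‖ ^ 2) (Ioc 0 1) :=
    (continuousOn_id.rpow_const fun x hx => Or.inl hx.1.ne').mul (hc.norm.pow 2)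
  refine ⟨hm.aestronglyMeasurable measurableSet_Ioc, ?_⟩
  rw [hasFiniteIntegral_iff_ofReal]
  · exact lt_top_iff_ne_top.2 h
  · filter_upwards [ae_restrict_mem measurableSet_Ioc] with x hx
    exact mul_nonneg (Real.rpow_nonneg hx.1.le _) (sq_nonneg _)

theorem HasFiniteEnergy.lintegral_eq {γ : ℝ} {u : ℝ → ℂ} (h : HasFiniteEnergy γ u) :
    ∫⁻ x in Ioc (0:ℝ) 1, ENNReal.ofReal (x ^ (-1 - 2 * γ) * ‖u x‖ ^ 2)
      = ENNReal.ofReal (weightedEnergy γ u) := by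
  rw [weightedEnergy, ofReal_integral_eq_lintegral_ofReal h.2]
  filter_upwards [ae_restrict_mem measurableSet_Ioc] with x hx
  exact mul_nonneg (Real.rpow_nonneg hx.1.le _) (sq_nonneg _)

theorem hasFiniteEnergy_fourierCoefAnn {s : ℕ} {σ γ : ℝ} {u : ℝ → ℝ → ℂ} (hu : SmoothAnn u)
    (h : TNormSq s σ γ u ≠ ⊤) (k : ℤ) {p : ℕ} (hp : p ≤ s) :
    HasFiniteEnergy γ (scaledDeriv p (fourierCoefAnn u k)) := by
  refine hasFiniteEnergy_of_lintegral_ne_top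
    ((contDiffOn_fourierCoefAnn hu.1 k).continuousOn_scaledDeriv p) ?_
  rw [← lintegral_kondratev_eq]
  have h1 := ENNReal.ne_top_of_tsum_ne_top h k
  have h2 := ENNReal.sum_ne_top.1 h1 p (by simp; omega)
  have h3 := ENNReal.sum_ne_top.1 h2 0 (by simp; omega)
  intro htop
  rw [htop, ENNReal.mul_top] at h3
  · exact h3 rfl
  · simpa using Real.exp_pos _

theorem sum_mode_eq {s : ℕ} {σ γ : ℝ} {f : ℝ → ℂ} (k : ℤ)
    (hf : ∀ p ≤ s, HasFiniteEnergy γ (scaledDeriv p f)) :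
    ∑ p ∈ Finset.range (s+1), ∑ q ∈ Finset.range (s+1-p),
      ENNReal.ofReal ((k:ℝ)^(2*q) * Real.exp (2*σ*((|k| : ℤ) : ℝ))) *
        ∫⁻ ψ in Ioc (0:ℝ) 1, ENNReal.ofReal (ψ ^ (2*((p:ℝ) - 1/2 - γ)) *
          ‖iteratedDeriv p f ψ‖^2)
      = ENNReal.ofReal (Real.exp (2*σ*((|k| : ℤ) : ℝ)) *
        ∑ p ∈ Finset.range (s+1), ∑ q ∈ Finset.range (s+1-p),
          (k:ℝ)^(2*q) * weightedEnergy γ (scaledDeriv p f)) := by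
  have hk : ∀ q : ℕ, 0 ≤ (k:ℝ) ^ (2 * q) := fun q => (even_two_mul q).pow_nonneg _
  simp only [Finset.mul_sum]
  rw [ENNReal.ofReal_sum_of_nonneg fun p _ => Finset.sum_nonneg fun q _ =>
    mul_nonneg (Real.exp_pos _).le (mul_nonneg (hk q) (weightedEnergy_nonneg γ _))]
  refine Finset.sum_congr rfl fun p hp => ?_
  rw [ENNReal.ofReal_sum_of_nonneg fun q _ =>
    mul_nonneg (Real.exp_pos _).le (mul_nonneg (hk q) (weightedEnergy_nonneg γ _))]
  refine Finset.sum_congr rfl fun q _ => ?_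
  rw [lintegral_kondratev_eq, (hf p (by simp at hp; omega)).lintegral_eq,
    ← ENNReal.ofReal_mul (mul_nonneg (hk q) (Real.exp_pos _).le)]
  congr 1
  ring

end AprioriEstimate

/-- **A priori estimate for the inhomogeneous degenerate problem**
`Lw = ψ²∂_ψ²w + 2ψ∂_ψw + (1/4)(w + ∂_θ²w) = η` with boundary conditions
`ŵ_k(1) = 0` for `|k| ≥ 3`: for `m ≥ 2`, `σ ≥ 0`, `1/2 < γ < 1` there is `C > 0`
such that `||| w |||_{m,σ,γ} ≤ C ||| η |||_{m-2,σ,γ}`. -/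
theorem inhomogeneous_apriori_estimate (m : ℕ) (hm : 2 ≤ m) (σ γ : ℝ)
    (hσ : 0 ≤ σ) (hγ1 : 1/2 < γ) (hγ2 : γ < 1) :
    ∃ C > 0, ∀ w η : ℝ → ℝ → ℂ, SmoothAnn w → SmoothAnn η →
      (∀ ψ ∈ Ioc (0:ℝ) 1, ∀ θ : ℝ,
        (ψ:ℂ)^2 * pder 2 0 w ψ θ + 2*(ψ:ℂ) * pder 1 0 w ψ θ
          + (1/4) * (w ψ θ + pder 0 2 w ψ θ) = η ψ θ) →
      (∀ k : ℤ, 3 ≤ |k| → fourierCoefAnn w k 1 = 0) →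
      TNormSq m σ γ w ≠ ⊤ → TNormSq (m-2) σ γ η ≠ ⊤ →
      (TNormSq m σ γ w) ^ ((1:ℝ)/2) ≤
        ENNReal.ofReal C * (TNormSq (m-2) σ γ η) ^ ((1:ℝ)/2) := by
  obtain ⟨C, hC, hmode⟩ := exists_mode_estimate m hm hγ1 hγ2
  refine ⟨(C + 1) ^ ((1:ℝ)/2), by positivity, fun w η hw hη heq hbc hwfin hηfin => ?_⟩
  rw [← ENNReal.ofReal_rpow_of_nonneg (by positivity) (by norm_num),
    ← ENNReal.mul_rpow_of_nonneg _ _ (by norm_num)]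
  refine ENNReal.rpow_le_rpow ?_ (by norm_num)
  rw [TNormSq, TNormSq, ← ENNReal.tsum_mul_left]
  refine ENNReal.tsum_le_tsum fun k => ?_
  have hwk := fun p (hp : p ≤ m) => hasFiniteEnergy_fourierCoefAnn hw hwfin k hp
  have hηk := fun p (hp : p ≤ m - 2) => hasFiniteEnergy_fourierCoefAnn hη hηfin k hp
  rw [sum_mode_eq k hwk, sum_mode_eq k hηk, ← ENNReal.ofReal_mul (by positivity), mul_left_comm]
  refine ENNReal.ofReal_le_ofReal (mul_le_mul_of_nonneg_left ?_ (Real.exp_pos _).le)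
  refine (hmode k _ _ (contDiffOn_fourierCoefAnn hw.1 k)
    (fun x hx => fourierCoefAnn_ode hw heq k hx) (hbc k) hwk hηk).trans ?_
  refine mul_le_mul_of_nonneg_right (by linarith) ?_
  exact Finset.sum_nonneg fun p _ => Finset.sum_nonneg fun q _ =>
    mul_nonneg ((even_two_mul q).pow_nonneg _) (weightedEnergy_nonneg γ _)
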